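/- For two pairs 𝒦 = (K, X) and 𝒦' = (K', X') each consisting of a compact metric space and a continuous path indexed by [0,1], define d_𝕂(𝒦, 𝒦') := (1/2) · inf{ dis ℭ : ℭ a correspondence between K and K' with (X_t, X'_t) ∈ ℭ for all t ∈ [0,1] }. Then for any three such pairs 𝒦₁, 𝒦₂, 𝒦₃, the triangle inequality holds: d_𝕂(𝒦₁, 𝒦₃) ≤ d_𝕂(𝒦₁, 𝒦₂) + d_𝕂(𝒦₂, 𝒦₃). -/

import Mathlib

/-- A correspondence between `A` and `B`: a subset of `A × B` whose projections to both
factors are surjective. -/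
def IsCorrespondence {A B : Type*} (C : Set (A × B)) : Prop :=
  (∀ a : A, ∃ b : B, (a, b) ∈ C) ∧ (∀ b : B, ∃ a : A, (a, b) ∈ C)

/-- The distortion of a subset `C ⊆ A × B`:
`sup { |d_A(a,c) − d_B(b,e)| : (a,b), (c,e) ∈ C }`. -/
noncomputable def corrDistortion {A B : Type*} [MetricSpace A] [MetricSpace B]
    (C : Set (A × B)) : ℝ :=
  sSup { r : ℝ | ∃ p ∈ C, ∃ q ∈ C, r = |dist p.1 q.1 - dist p.2 q.2| }

/-- The path-decorated Gromov–Hausdorff distance between a compact metric space `A` carrying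
a path `X : [0,1] → A` and a compact metric space `B` carrying a path `Y : [0,1] → B`:
half the infimal distortion over all correspondences containing `(X_t, Y_t)` for all `t`. -/
noncomputable def pathGHDist {A B : Type*} [MetricSpace A] [MetricSpace B]
    (X : Set.Icc (0 : ℝ) 1 → A) (Y : Set.Icc (0 : ℝ) 1 → B) : ℝ :=
  (1 / 2) * sInf { r : ℝ | ∃ C : Set (A × B), IsCorrespondence C ∧
    (∀ t : Set.Icc (0 : ℝ) 1, (X t, Y t) ∈ C) ∧ r = corrDistortion C }

open scoped Pointwise

theorem isCorrespondence_univ {A B : Type*} [Nonempty A] [Nonempty B] :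
    IsCorrespondence (Set.univ : Set (A × B)) :=
  ⟨fun _ => ⟨Classical.arbitrary B, trivial⟩, fun _ => ⟨Classical.arbitrary A, trivial⟩⟩

theorem IsCorrespondence.comp {A B C : Type*} {R : Set (A × B)} {S : Set (B × C)}
    (hR : IsCorrespondence R) (hS : IsCorrespondence S) :
    IsCorrespondence (SetRel.comp R S) := by
  refine ⟨fun a => ?_, fun c => ?_⟩
  · obtain ⟨b, hb⟩ := hR.1 a
    obtain ⟨c, hc⟩ := hS.1 b
    exact ⟨c, b, hb, hc⟩
  · obtain ⟨b, hb⟩ := hS.2 c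
    obtain ⟨a, ha⟩ := hR.2 b
    exact ⟨a, b, ha, hb⟩

section Distortion

variable {A B C : Type*} [MetricSpace A] [MetricSpace B] [MetricSpace C]

theorem corrDistortion_nonneg (R : Set (A × B)) : 0 ≤ corrDistortion R := by
  refine Real.sSup_nonneg ?_
  rintro _ ⟨p, _, q, _, rfl⟩
  exact abs_nonneg _

theorem abs_dist_sub_dist_le_corrDistortion [CompactSpace A] [CompactSpace B]
    {R : Set (A × B)} {p q : A × B} (hp : p ∈ R) (hq : q ∈ R) :
    |dist p.1 q.1 - dist p.2 q.2| ≤ corrDistortion R := by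
  refine le_csSup ⟨Metric.diam (Set.univ : Set A) + Metric.diam (Set.univ : Set B), ?_⟩
    ⟨p, hp, q, hq, rfl⟩
  rintro _ ⟨x, _, y, _, rfl⟩
  have hA := Metric.dist_le_diam_of_mem isCompact_univ.isBounded
    (Set.mem_univ x.1) (Set.mem_univ y.1)
  have hB := Metric.dist_le_diam_of_mem isCompact_univ.isBounded
    (Set.mem_univ x.2) (Set.mem_univ y.2)
  have hA₀ := dist_nonneg (x := x.1) (y := y.1)
  have hB₀ := dist_nonneg (x := x.2) (y := y.2)
  exact abs_le.2 ⟨by linarith, by linarith⟩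

theorem corrDistortion_comp_le [CompactSpace A] [CompactSpace B] [CompactSpace C]
    (R : Set (A × B)) (S : Set (B × C)) :
    corrDistortion (SetRel.comp R S) ≤ corrDistortion R + corrDistortion S := by
  refine Real.sSup_le ?_ (add_nonneg (corrDistortion_nonneg R) (corrDistortion_nonneg S))
  rintro _ ⟨⟨a, c⟩, ⟨b, hab, hbc⟩, ⟨a', c'⟩, ⟨b', hab', hbc'⟩, rfl⟩
  exact (abs_sub_le _ (dist b b') _).trans
    (add_le_add (abs_dist_sub_dist_le_corrDistortion hab hab')
      (abs_dist_sub_dist_le_corrDistortion hbc hbc'))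

/-- The distortions of the correspondences that contain `(X t, Y t)` for all `t`. -/
def pathDistortions (X : Set.Icc (0 : ℝ) 1 → A) (Y : Set.Icc (0 : ℝ) 1 → B) : Set ℝ :=
  { r : ℝ | ∃ R : Set (A × B), IsCorrespondence R ∧
    (∀ t : Set.Icc (0 : ℝ) 1, (X t, Y t) ∈ R) ∧ r = corrDistortion R }

theorem pathDistortions_nonempty (X : Set.Icc (0 : ℝ) 1 → A) (Y : Set.Icc (0 : ℝ) 1 → B) :
    (pathDistortions X Y).Nonempty :=
  haveI : Nonempty A := ⟨X 0⟩
  haveI : Nonempty B := ⟨Y 0⟩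
  ⟨_, Set.univ, isCorrespondence_univ, fun _ => trivial, rfl⟩

theorem pathDistortions_bddBelow (X : Set.Icc (0 : ℝ) 1 → A) (Y : Set.Icc (0 : ℝ) 1 → B) :
    BddBelow (pathDistortions X Y) := by
  refine ⟨0, ?_⟩
  rintro _ ⟨R, _, _, rfl⟩
  exact corrDistortion_nonneg R

theorem sInf_pathDistortions_le_add [CompactSpace A] [CompactSpace B] [CompactSpace C]
    (X : Set.Icc (0 : ℝ) 1 → A) (Y : Set.Icc (0 : ℝ) 1 → B) (Z : Set.Icc (0 : ℝ) 1 → C) :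
    sInf (pathDistortions X Z) ≤ sInf (pathDistortions X Y) + sInf (pathDistortions Y Z) := by
  rw [← csInf_add (pathDistortions_nonempty X Y) (pathDistortions_bddBelow X Y)
    (pathDistortions_nonempty Y Z) (pathDistortions_bddBelow Y Z)]
  refine le_csInf ((pathDistortions_nonempty X Y).add (pathDistortions_nonempty Y Z)) ?_
  rintro _ ⟨_, ⟨R, hR, hXY, rfl⟩, _, ⟨S, hS, hYZ, rfl⟩, rfl⟩
  exact (csInf_le (pathDistortions_bddBelow X Z)
    ⟨_, hR.comp hS, fun t => ⟨Y t, hXY t, hYZ t⟩, rfl⟩).trans (corrDistortion_comp_le R S)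

end Distortion

/-- The triangle inequality for the path-decorated Gromov–Hausdorff distance on pairs
consisting of a compact metric space and a continuous path indexed by `[0,1]`. -/
theorem pathGHDist_triangle {K₁ K₂ K₃ : Type*}
    [MetricSpace K₁] [MetricSpace K₂] [MetricSpace K₃]
    [CompactSpace K₁] [CompactSpace K₂] [CompactSpace K₃]
    (X₁ : Set.Icc (0 : ℝ) 1 → K₁) (X₂ : Set.Icc (0 : ℝ) 1 → K₂)
    (X₃ : Set.Icc (0 : ℝ) 1 → K₃)
    (hX₁ : Continuous X₁) (hX₂ : Continuous X₂) (hX₃ : Continuous X₃) :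
    pathGHDist X₁ X₃ ≤ pathGHDist X₁ X₂ + pathGHDist X₂ X₃ := by
  change 1 / 2 * sInf (pathDistortions X₁ X₃) ≤
    1 / 2 * sInf (pathDistortions X₁ X₂) + 1 / 2 * sInf (pathDistortions X₂ X₃)
  linarith [sInf_pathDistortions_le_add X₁ X₂ X₃]
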